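/- arXiv:1802.03616 — 2 statements merged into one kernel-verified Lean document; each statement's English description precedes it below -/
import Mathlib

section
/- Let Λ = {Λ_ω ∈ B(H,E) : ω ∈ Ω} and Θ = {Θ_ω ∈ B(H,E) : ω ∈ Ω} be two disjoint continuous g-frames for H with respect to E, and let L₁, L₂ ∈ B(H). If L₁ or L₂ is surjective, then {Λ_ω L₁* + Θ_ω L₂* : ω ∈ Ω} is a continuous g-frame for H with respect to E. -/
open MeasureTheory
open scoped ENNReal NNReal Pointwise

noncomputable section

local notation "⟪" x ", " y "⟫" => @inner ℂ _ _ x y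

variable {Ω : Type*} [MeasurableSpace Ω]

section Defs

variable {F G E : Type*}
  [NormedAddCommGroup F] [InnerProductSpace ℂ F]
  [NormedAddCommGroup G] [InnerProductSpace ℂ G]
  [NormedAddCommGroup E] [InnerProductSpace ℂ E]

/-- `Λ` is a continuous g-frame for `F` with respect to `E`, with frame bounds `A`, `B`:
for every `f`, `ω ↦ Λ ω f` is strongly measurable and
`A‖f‖² ≤ ∫ ‖Λ ω f‖² dμ(ω) ≤ B‖f‖²`. -/
def IsCgFrame (μ : Measure Ω) (Λ : Ω → F →L[ℂ] E) (A B : ℝ) : Prop :=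
  (∀ f : F, StronglyMeasurable fun ω => Λ ω f) ∧
    ∀ f : F,
      ENNReal.ofReal (A * ‖f‖ ^ 2) ≤ ∫⁻ ω, (‖Λ ω f‖₊ : ℝ≥0∞) ^ 2 ∂μ ∧
        ∫⁻ ω, (‖Λ ω f‖₊ : ℝ≥0∞) ^ 2 ∂μ ≤ ENNReal.ofReal (B * ‖f‖ ^ 2)

/-- `Λ` is a continuous g-Bessel family with Bessel constant `B`. -/
def IsCgBessel (μ : Measure Ω) (Λ : Ω → F →L[ℂ] E) (B : ℝ) : Prop :=
  (∀ f : F, StronglyMeasurable fun ω => Λ ω f) ∧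
    ∀ f : F, ∫⁻ ω, (‖Λ ω f‖₊ : ℝ≥0∞) ^ 2 ∂μ ≤ ENNReal.ofReal (B * ‖f‖ ^ 2)

/-- `Λ` is a tight continuous g-frame with bound `A`. -/
def IsCgTight (μ : Measure Ω) (Λ : Ω → F →L[ℂ] E) (A : ℝ) : Prop :=
  (∀ f : F, StronglyMeasurable fun ω => Λ ω f) ∧
    ∀ f : F, ∫⁻ ω, (‖Λ ω f‖₊ : ℝ≥0∞) ^ 2 ∂μ = ENNReal.ofReal (A * ‖f‖ ^ 2)

/-- `Λ` is a Parseval continuous g-frame. -/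
def IsCgParseval (μ : Measure Ω) (Λ : Ω → F →L[ℂ] E) : Prop :=
  (∀ f : F, StronglyMeasurable fun ω => Λ ω f) ∧
    ∀ f : F, ∫⁻ ω, (‖Λ ω f‖₊ : ℝ≥0∞) ^ 2 ∂μ = ENNReal.ofReal (‖f‖ ^ 2)

/-- The range of the analysis operator `T*_Λ : F → Ê = L²(Ω,μ;E)`, i.e. the set of elements of
`L²(Ω,μ;E)` represented by `ω ↦ Λ ω f` for some `f : F`. -/
def analysisRange (μ : Measure Ω) (Λ : Ω → F →L[ℂ] E) : Set (Lp E 2 μ) :=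
  {φ | ∃ f : F, (fun ω => Λ ω f) =ᵐ[μ] (φ : Ω → E)}

/-- `Λ` and `Θ` are strongly disjoint: the ranges of their analysis operators are orthogonal,
equivalently `∫ ⟨Λ ω h, Θ ω k⟩ dμ(ω) = 0` for all `h`, `k`. -/
def StronglyDisjoint (μ : Measure Ω) (Λ : Ω → F →L[ℂ] E) (Θ : Ω → G →L[ℂ] E) : Prop :=
  ∀ (h : F) (k : G), ∫ ω, ⟪Λ ω h, Θ ω k⟫ ∂μ = 0

/-- `Λ` and `Θ` are disjoint: `Range T*_Λ ∩ Range T*_Θ = {0}` and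
`Range T*_Λ + Range T*_Θ` is closed in `Ê`. -/
def IsDisjoint (μ : Measure Ω) (Λ : Ω → F →L[ℂ] E) (Θ : Ω → G →L[ℂ] E) : Prop :=
  analysisRange μ Λ ∩ analysisRange μ Θ = {(0 : Lp E 2 μ)} ∧
    IsClosed (analysisRange μ Λ + analysisRange μ Θ)

/-- `Λ` and `Θ` are weakly disjoint: `Range T*_Λ ∩ Range T*_Θ = {0}`. -/
def WeaklyDisjoint (μ : Measure Ω) (Λ : Ω → F →L[ℂ] E) (Θ : Ω → G →L[ℂ] E) : Prop :=
  analysisRange μ Λ ∩ analysisRange μ Θ = {(0 : Lp E 2 μ)}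

/-- `Λ` and `Θ` are a complementary pair: `Range T*_Λ ∩ Range T*_Θ = {0}` and
`Range T*_Λ + Range T*_Θ = Ê`. -/
def ComplementaryPair (μ : Measure Ω) (Λ : Ω → F →L[ℂ] E) (Θ : Ω → G →L[ℂ] E) : Prop :=
  analysisRange μ Λ ∩ analysisRange μ Θ = {(0 : Lp E 2 μ)} ∧
    analysisRange μ Λ + analysisRange μ Θ = (Set.univ : Set (Lp E 2 μ))

/-- `Λ` and `Θ` are a strongly complementary pair: `Ê` is the orthogonal direct sum of
`Range T*_Λ` and `Range T*_Θ`. -/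
def StronglyComplementaryPair (μ : Measure Ω) (Λ : Ω → F →L[ℂ] E) (Θ : Ω → G →L[ℂ] E) : Prop :=
  StronglyDisjoint μ Λ Θ ∧
    analysisRange μ Λ + analysisRange μ Θ = (Set.univ : Set (Lp E 2 μ))

/-- `S` is the (continuous g-)frame operator of `Λ`:
`⟨S f, g⟩ = ∫ ⟨Λ ω f, Λ ω g⟩ dμ(ω)`. -/
def IsFrameOperator (μ : Measure Ω) (Λ : Ω → F →L[ℂ] E) (S : F →L[ℂ] F) : Prop :=
  ∀ f g : F, ⟪S f, g⟫ = ∫ ω, ⟪Λ ω f, Λ ω g⟫ ∂μ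

/-- `Θ` is a dual of `Λ`: `∫ ⟨Θ ω f, Λ ω g⟩ dμ(ω) = ⟨f, g⟩` for all `f`, `g`. -/
def IsDualOf (μ : Measure Ω) (Θ Λ : Ω → F →L[ℂ] E) : Prop :=
  ∀ f g : F, ∫ ω, ⟪Θ ω f, Λ ω g⟫ ∂μ = ⟪f, g⟫

/-- `Λ` is a Riesz-type continuous g-frame: it is a continuous g-frame and every dual of `Λ`
is weakly equal to the canonical dual `{Λ_ω S_Λ⁻¹}`, where `S_Λ` is the frame operator. -/
def IsRieszType (μ : Measure Ω) (Λ : Ω → F →L[ℂ] E) : Prop :=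
  (∃ A B : ℝ, 0 < A ∧ IsCgFrame μ Λ A B) ∧
    ∀ S : F ≃L[ℂ] F, IsFrameOperator μ Λ (S : F →L[ℂ] F) →
      ∀ Θ : Ω → F →L[ℂ] E, (∃ A B : ℝ, 0 < A ∧ IsCgFrame μ Θ A B) → IsDualOf μ Θ Λ →
        ∀ f : F, ∀ᵐ ω ∂μ, Θ ω f = Λ ω (S.symm f)

/-- The operator `h ⊕ k ↦ Λω h + Θω k` on the Hilbert direct sum `F ⊕ G = WithLp 2 (F × G)`. -/
def pairMap (Λω : F →L[ℂ] E) (Θω : G →L[ℂ] E) : WithLp 2 (F × G) →L[ℂ] E :=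
  (Λω.comp (ContinuousLinearMap.fst ℂ F G) + Θω.comp (ContinuousLinearMap.snd ℂ F G)).comp
    (WithLp.prodContinuousLinearEquiv 2 ℂ F G).toContinuousLinearMap

end Defs

theorem lintegral_nnnorm_sq_eq_of_ae_eq {E : Type*} [NormedAddCommGroup E] {μ : Measure Ω}
    {g : Ω → E} {φ : Lp E 2 μ} (h : g =ᵐ[μ] φ) :
    ∫⁻ ω, (‖g ω‖₊ : ℝ≥0∞) ^ 2 ∂μ = ENNReal.ofReal (‖φ‖ ^ 2) := by
  have h1 : ∫⁻ ω, (‖g ω‖₊ : ℝ≥0∞) ^ 2 ∂μ = eLpNorm φ 2 μ ^ 2 := by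
    rw [← eLpNorm_congr_ae h]
    have := eLpNorm_nnreal_pow_eq_lintegral (p := 2) (f := g) (μ := μ) two_ne_zero
    simpa [enorm_eq_nnnorm] using this.symm
  rw [h1, ← Lp.enorm_def, ← ofReal_norm, ENNReal.ofReal_pow (norm_nonneg _)]

/-- The analysis operator of a continuous g-Bessel family. -/
theorem IsCgBessel.exists_analysis {F E : Type*}
    [NormedAddCommGroup F] [InnerProductSpace ℂ F]
    [NormedAddCommGroup E] [InnerProductSpace ℂ E]
    {μ : Measure Ω} {Λ : Ω → F →L[ℂ] E} {B : ℝ} (h : IsCgBessel μ Λ B) :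
    ∃ T : F →L[ℂ] Lp E 2 μ, ∀ f, (fun ω => Λ ω f) =ᵐ[μ] T f := by
  have hmem : ∀ f, MemLp (fun ω => Λ ω f) 2 μ := fun f => by
    refine ⟨(h.1 f).aestronglyMeasurable, ?_⟩
    have h1 := eLpNorm_nnreal_pow_eq_lintegral (p := 2) (f := fun ω => Λ ω f) (μ := μ) two_ne_zero
    have h2 : eLpNorm (fun ω => Λ ω f) 2 μ ^ 2 = ∫⁻ ω, (‖Λ ω f‖₊ : ℝ≥0∞) ^ 2 ∂μ := by
      simpa [enorm_eq_nnnorm] using h1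
    have h3 : eLpNorm (fun ω => Λ ω f) 2 μ ^ 2 < ∞ :=
      h2 ▸ (h.2 f).trans_lt ENNReal.ofReal_lt_top
    exact (ENNReal.pow_lt_top_iff.1 h3).resolve_right two_ne_zero
  have hcoe : ∀ f, (fun ω => Λ ω f) =ᵐ[μ] (hmem f).toLp := fun f => (hmem f).coeFn_toLp.symm
  let T : F →ₗ[ℂ] Lp E 2 μ :=
    { toFun := fun f => (hmem f).toLp
      map_add' := fun f g => by
        rw [← MemLp.toLp_add]
        exact MemLp.toLp_congr _ _ (.of_forall fun ω => by simp)
      map_smul' := fun c f => by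
        rw [RingHom.id_apply, ← MemLp.toLp_const_smul]
        exact MemLp.toLp_congr _ _ (.of_forall fun ω => by simp) }
  refine ⟨T.mkContinuous (√|B|) fun f => ?_, hcoe⟩
  have h1 : ENNReal.ofReal (‖T f‖ ^ 2) ≤ ENNReal.ofReal (|B| * ‖f‖ ^ 2) := by
    rw [← lintegral_nnnorm_sq_eq_of_ae_eq (φ := T f) (hcoe f)]
    refine (h.2 f).trans (ENNReal.ofReal_le_ofReal ?_)
    gcongr
    exact le_abs_self B
  rw [ENNReal.ofReal_le_ofReal_iff (by positivity)] at h1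
  refine le_of_sq_le_sq ?_ (by positivity)
  rwa [mul_pow, Real.sq_sqrt (abs_nonneg B)]

theorem IsCgFrame.isCgBessel {F E : Type*}
    [NormedAddCommGroup F] [InnerProductSpace ℂ F]
    [NormedAddCommGroup E] [InnerProductSpace ℂ E]
    {μ : Measure Ω} {Λ : Ω → F →L[ℂ] E} {A B : ℝ} (h : IsCgFrame μ Λ A B) :
    IsCgBessel μ Λ B :=
  ⟨h.1, fun f => (h.2 f).2⟩

theorem IsCgFrame.eq_zero_of_analysis_eq_zero {F E : Type*}
    [NormedAddCommGroup F] [InnerProductSpace ℂ F]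
    [NormedAddCommGroup E] [InnerProductSpace ℂ E]
    {μ : Measure Ω} {Λ : Ω → F →L[ℂ] E} {A B : ℝ} (h : IsCgFrame μ Λ A B) (hA : 0 < A)
    {f : F} (hf : (fun ω => Λ ω f) =ᵐ[μ] (0 : Lp E 2 μ)) : f = 0 := by
  have h1 := (h.2 f).1
  rw [lintegral_nnnorm_sq_eq_of_ae_eq hf, norm_zero, zero_pow two_ne_zero, ENNReal.ofReal_zero,
    nonpos_iff_eq_zero, ENNReal.ofReal_eq_zero] at h1
  by_contra hne
  have : 0 < ‖f‖ := norm_pos_iff.2 hne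
  exact absurd h1 (not_le.2 (by positivity))

theorem analysisRange_eq_range {F E : Type*}
    [NormedAddCommGroup F] [InnerProductSpace ℂ F]
    [NormedAddCommGroup E] [InnerProductSpace ℂ E]
    {μ : Measure Ω} {Λ : Ω → F →L[ℂ] E} {T : F →L[ℂ] Lp E 2 μ}
    (hT : ∀ f, (fun ω => Λ ω f) =ᵐ[μ] T f) : analysisRange μ Λ = Set.range T := by
  ext φ
  exact exists_congr fun f =>
    ⟨fun hf => Lp.ext ((hT f).symm.trans hf), fun hf => hf ▸ hT f⟩

theorem ContinuousLinearMap.exists_norm_le_mul_norm_adjoint_of_surjective {H K : Type*}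
    [NormedAddCommGroup H] [InnerProductSpace ℂ H] [CompleteSpace H]
    [NormedAddCommGroup K] [InnerProductSpace ℂ K] [CompleteSpace K]
    {L : H →L[ℂ] K} (hL : Function.Surjective L) :
    ∃ C > 0, ∀ f, ‖f‖ ≤ C * ‖ContinuousLinearMap.adjoint L f‖ := by
  obtain ⟨C, hC, hpre⟩ := L.exists_preimage_norm_le hL
  refine ⟨C, hC, fun f => ?_⟩
  obtain ⟨x, rfl, hx⟩ := hpre f
  rcases (norm_nonneg (L x)).eq_or_lt with h0 | h0
  · rw [← h0]; positivity
  refine le_of_mul_le_mul_right ?_ h0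
  calc ‖L x‖ * ‖L x‖ = ‖⟪x, ContinuousLinearMap.adjoint L (L x)⟫‖ := by
        rw [ContinuousLinearMap.adjoint_inner_right, inner_self_eq_norm_sq_to_K, norm_pow,
          RCLike.norm_ofReal, abs_norm, sq]
    _ ≤ ‖x‖ * ‖ContinuousLinearMap.adjoint L (L x)‖ := norm_inner_le_norm _ _
    _ ≤ C * ‖L x‖ * ‖ContinuousLinearMap.adjoint L (L x)‖ := by gcongr
    _ = C * ‖ContinuousLinearMap.adjoint L (L x)‖ * ‖L x‖ := by ring

theorem IsDisjoint.exists_norm_le {F G E : Type*}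
    [NormedAddCommGroup F] [InnerProductSpace ℂ F] [CompleteSpace F]
    [NormedAddCommGroup G] [InnerProductSpace ℂ G] [CompleteSpace G]
    [NormedAddCommGroup E] [InnerProductSpace ℂ E] [CompleteSpace E]
    {μ : Measure Ω} {Λ : Ω → F →L[ℂ] E} {Θ : Ω → G →L[ℂ] E} {A B A' B' : ℝ}
    (hdis : IsDisjoint μ Λ Θ) (hA : 0 < A) (hA' : 0 < A')
    (hΛ : IsCgFrame μ Λ A B) (hΘ : IsCgFrame μ Θ A' B')
    {S : F →L[ℂ] Lp E 2 μ} (hS : ∀ f, (fun ω => Λ ω f) =ᵐ[μ] S f)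
    {T : G →L[ℂ] Lp E 2 μ} (hT : ∀ g, (fun ω => Θ ω g) =ᵐ[μ] T g) :
    ∃ C > 0, ∀ f g, ‖(f, g)‖ ≤ C * ‖S f + T g‖ := by
  obtain ⟨hinter, hclosed⟩ := hdis
  rw [analysisRange_eq_range hS, analysisRange_eq_range hT] at hinter hclosed
  have hinj : Function.Injective (S.coprod T) := by
    refine (injective_iff_map_eq_zero _).2 fun ⟨f, g⟩ h => ?_
    have h' : S f + T g = 0 := by simpa using h
    have hmem : S f ∈ Set.range S ∩ Set.range T :=
      ⟨⟨f, rfl⟩, -g, by rw [map_neg]; exact (eq_neg_of_add_eq_zero_left h').symm⟩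
    rw [hinter, Set.mem_singleton_iff] at hmem
    rw [hmem, zero_add] at h'
    have hf := hS f
    have hg := hT g
    rw [hmem] at hf
    rw [h'] at hg
    rw [hΛ.eq_zero_of_analysis_eq_zero hA hf, hΘ.eq_zero_of_analysis_eq_zero hA' hg,
      Prod.mk_zero_zero]
  have hrange : IsClosed (Set.range (S.coprod T)) := by
    convert hclosed using 1
    ext φ
    simp [Set.mem_add]
  obtain ⟨C, hC⟩ := (S.coprod T).antilipschitz_of_injective_of_isClosed_range hinj hrange
  refine ⟨C + 1, by positivity, fun f g => ?_⟩
  calc ‖(f, g)‖ ≤ C * ‖S.coprod T (f, g)‖ := ZeroHomClass.bound_of_antilipschitz _ hC _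
    _ ≤ (C + 1) * ‖S f + T g‖ := by
      rw [ContinuousLinearMap.coprod_apply]
      gcongr
      simp

variable {H K E : Type*}
  [NormedAddCommGroup H] [InnerProductSpace ℂ H] [CompleteSpace H]
  [NormedAddCommGroup K] [InnerProductSpace ℂ K] [CompleteSpace K]
  [NormedAddCommGroup E] [InnerProductSpace ℂ E] [CompleteSpace E]

/-- if `Λ`, `Θ` are disjoint continuous g-frames and `L₁` or `L₂` is surjective,
then `{Λ_ω L₁* + Θ_ω L₂*}` is a continuous g-frame. -/
theorem stmt5 (μ : Measure Ω) (Λ Θ : Ω → H →L[ℂ] E)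
    (AL BL AT BT : ℝ) (hAL : 0 < AL) (hAT : 0 < AT)
    (hL : IsCgFrame μ Λ AL BL) (hT : IsCgFrame μ Θ AT BT)
    (hdis : IsDisjoint μ Λ Θ) (L₁ L₂ : H →L[ℂ] H)
    (hsurj : Function.Surjective ⇑L₁ ∨ Function.Surjective ⇑L₂) :
    ∃ A B : ℝ, 0 < A ∧ IsCgFrame μ
      (fun ω => (Λ ω).comp (ContinuousLinearMap.adjoint L₁) +
        (Θ ω).comp (ContinuousLinearMap.adjoint L₂)) A B := by
  obtain ⟨S, hS⟩ := hL.isCgBessel.exists_analysis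
  obtain ⟨T, hT'⟩ := hT.isCgBessel.exists_analysis
  obtain ⟨C, hC, hle⟩ := hdis.exists_norm_le hAL hAT hL hT hS hT'
  obtain ⟨D, hD, hD'⟩ : ∃ D > 0, ∀ f, ‖f‖ ≤
      D * ‖(ContinuousLinearMap.adjoint L₁ f, ContinuousLinearMap.adjoint L₂ f)‖ := by
    rcases hsurj with h | h <;>
      obtain ⟨D, hD, h⟩ :=
        ContinuousLinearMap.exists_norm_le_mul_norm_adjoint_of_surjective h <;>
      refine ⟨D, hD, fun f => (h f).trans ?_⟩ <;> gcongr
    exacts [norm_fst_le (_, _), norm_snd_le (_, _)]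
  let R : H →L[ℂ] Lp E 2 μ :=
    S.comp (ContinuousLinearMap.adjoint L₁) + T.comp (ContinuousLinearMap.adjoint L₂)
  have hR : ∀ f, (fun ω => ((Λ ω).comp (ContinuousLinearMap.adjoint L₁) +
      (Θ ω).comp (ContinuousLinearMap.adjoint L₂)) f) =ᵐ[μ] R f := fun f =>
    ((hS _).add (hT' _)).trans (Lp.coeFn_add _ _).symm
  refine ⟨((D * C) ^ 2)⁻¹, ‖R‖ ^ 2, by positivity, fun f => (hL.1 _).add (hT.1 _), fun f => ?_⟩
  rw [lintegral_nnnorm_sq_eq_of_ae_eq (hR f)]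
  constructor <;> refine ENNReal.ofReal_le_ofReal ?_
  · rw [inv_mul_le_iff₀ (by positivity), ← mul_pow]
    gcongr
    calc ‖f‖ ≤ _ := hD' f
      _ ≤ D * (C * ‖R f‖) := by gcongr; exact hle _ _
      _ = D * C * ‖R f‖ := by ring
  · rw [← mul_pow]
    gcongr
    exact R.le_opNorm f
end
end

section
/- Let Λ = {Λ_ω ∈ B(H,E) : ω ∈ Ω} and Θ = {Θ_ω ∈ B(H,E) : ω ∈ Ω} be two disjoint continuous g-frames for H with respect to E. Then Λ + Θ = {Λ_ω + Θ_ω : ω ∈ Ω} is a continuous g-frame for H with respect to E. -/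
open MeasureTheory
open scoped ENNReal NNReal Pointwise

noncomputable section

local notation "⟪" x ", " y "⟫" => @inner ℂ _ _ x y

variable {Ω : Type*} [MeasurableSpace Ω]

section L2Norm

variable {E : Type*} [NormedAddCommGroup E] {μ : Measure Ω}

theorem eLpNorm_two_sq (g : Ω → E) :
    eLpNorm g 2 μ ^ 2 = ∫⁻ ω, (‖g ω‖₊ : ℝ≥0∞) ^ 2 ∂μ := by
  simpa [enorm_eq_nnnorm] using
    eLpNorm_nnreal_pow_eq_lintegral (μ := μ) (f := g) (p := 2) two_ne_zero

theorem lintegral_eq_ofReal_norm_toLp_sq {g : Ω → E} (hg : MemLp g 2 μ) :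
    ∫⁻ ω, (‖g ω‖₊ : ℝ≥0∞) ^ 2 ∂μ = ENNReal.ofReal (‖hg.toLp g‖ ^ 2) := by
  rw [Lp.norm_toLp, ENNReal.ofReal_pow ENNReal.toReal_nonneg,
    ENNReal.ofReal_toReal hg.eLpNorm_ne_top, eLpNorm_two_sq]

end L2Norm

section AnalysisOperator

variable {F E : Type*}
  [NormedAddCommGroup F] [InnerProductSpace ℂ F]
  [NormedAddCommGroup E] [InnerProductSpace ℂ E]
  {μ : Measure Ω} {Λ : Ω → F →L[ℂ] E} {A B : ℝ}

theorem IsCgFrame.isCgBessel_s6 (h : IsCgFrame μ Λ A B) : IsCgBessel μ Λ B :=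
  ⟨h.1, fun f => (h.2 f).2⟩

theorem IsCgBessel.memLp (h : IsCgBessel μ Λ B) (f : F) : MemLp (fun ω => Λ ω f) 2 μ := by
  refine ⟨(h.1 f).aestronglyMeasurable, ?_⟩
  have hlt := (h.2 f).trans_lt ENNReal.ofReal_lt_top
  rw [← eLpNorm_two_sq] at hlt
  simpa using hlt

/-- The analysis operator of a continuous g-Bessel family, into `L²(Ω, μ; E)`. -/
def IsCgBessel.analysisOp (h : IsCgBessel μ Λ B) : F →L[ℂ] Lp E 2 μ :=
  LinearMap.mkContinuous
    { toFun := fun f => (h.memLp f).toLp _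
      map_add' := fun f g => by
        rw [← MemLp.toLp_add]
        exact MemLp.toLp_congr _ _ (.of_forall fun ω => map_add (Λ ω) f g)
      map_smul' := fun c f => by
        rw [RingHom.id_apply, ← MemLp.toLp_const_smul]
        exact MemLp.toLp_congr _ _ (.of_forall fun ω => map_smul (Λ ω) c f) }
    √|B| fun f => by
      have hf := h.2 f
      rw [lintegral_eq_ofReal_norm_toLp_sq (h.memLp f)] at hf
      have hle : B * ‖f‖ ^ 2 ≤ |B| * ‖f‖ ^ 2 := by gcongr; exact le_abs_self B
      have hsq := (ENNReal.ofReal_le_ofReal_iff (by positivity)).1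
        (hf.trans (ENNReal.ofReal_le_ofReal hle))
      refine le_of_sq_le_sq ?_ (by positivity)
      rwa [mul_pow, Real.sq_sqrt (abs_nonneg B)]

theorem IsCgBessel.coeFn_analysisOp (h : IsCgBessel μ Λ B) (f : F) :
    h.analysisOp f =ᵐ[μ] fun ω => Λ ω f :=
  (h.memLp f).coeFn_toLp

theorem IsCgBessel.lintegral_eq (h : IsCgBessel μ Λ B) (f : F) :
    ∫⁻ ω, (‖Λ ω f‖₊ : ℝ≥0∞) ^ 2 ∂μ = ENNReal.ofReal (‖h.analysisOp f‖ ^ 2) :=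
  lintegral_eq_ofReal_norm_toLp_sq (h.memLp f)

theorem IsCgBessel.analysisRange_eq (h : IsCgBessel μ Λ B) :
    analysisRange μ Λ = Set.range h.analysisOp := by
  ext φ
  exact exists_congr fun f =>
    ⟨fun hf => Lp.ext ((h.coeFn_analysisOp f).trans hf),
      fun hf => hf ▸ (h.coeFn_analysisOp f).symm⟩

theorem IsCgFrame.eq_zero_of_analysisOp_eq_zero (h : IsCgFrame μ Λ A B) (hA : 0 < A) {f : F}
    (hf : h.isCgBessel_s6.analysisOp f = 0) : f = 0 := by
  have hle := (h.2 f).1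
  rw [h.isCgBessel_s6.lintegral_eq, hf] at hle
  have hle' : A * ‖f‖ ^ 2 ≤ 0 := by simpa using hle
  have hsq : ‖f‖ ^ 2 ≤ 0 := by nlinarith
  simpa using le_antisymm hsq (sq_nonneg _)

end AnalysisOperator

variable {H K E : Type*}
  [NormedAddCommGroup H] [InnerProductSpace ℂ H] [CompleteSpace H]
  [NormedAddCommGroup K] [InnerProductSpace ℂ K] [CompleteSpace K]
  [NormedAddCommGroup E] [InnerProductSpace ℂ E] [CompleteSpace E]

/-- if `Λ`, `Θ` are disjoint continuous g-frames, then `{Λ_ω + Θ_ω}` is a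
continuous g-frame. -/
theorem stmt6 (μ : Measure Ω) (Λ Θ : Ω → H →L[ℂ] E)
    (AL BL AT BT : ℝ) (hAL : 0 < AL) (hAT : 0 < AT)
    (hL : IsCgFrame μ Λ AL BL) (hT : IsCgFrame μ Θ AT BT)
    (hdis : IsDisjoint μ Λ Θ) :
    ∃ A B : ℝ, 0 < A ∧ IsCgFrame μ (fun ω => Λ ω + Θ ω) A B := by
  have hLb := hL.isCgBessel_s6
  have hTb := hT.isCgBessel_s6
  obtain ⟨hinter, hclosed⟩ := hdis
  rw [hLb.analysisRange_eq, hTb.analysisRange_eq] at hinter hclosed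
  set S : H →L[ℂ] Lp E 2 μ := hLb.analysisOp
  set T : H →L[ℂ] Lp E 2 μ := hTb.analysisOp
  have hrange : Set.range (S.coprod T) = Set.range S + Set.range T := by
    ext φ
    simp [Set.mem_add]
  have hinj : Function.Injective (S.coprod T) := by
    rw [injective_iff_map_eq_zero]
    rintro ⟨f, g⟩ hfg
    have hfg' : S f = T (-g) := by
      rw [map_neg]
      exact eq_neg_of_add_eq_zero_left (by simpa using hfg)
    have hSf : S f = 0 := by
      have hmem : S f ∈ Set.range S ∩ Set.range T := ⟨⟨f, rfl⟩, ⟨-g, hfg'.symm⟩⟩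
      simpa [hinter] using hmem
    have hTg : T g = 0 := by simpa [hSf] using hfg
    exact Prod.ext (hL.eq_zero_of_analysisOp_eq_zero hAL hSf)
      (hT.eq_zero_of_analysisOp_eq_zero hAT hTg)
  obtain ⟨c, hanti⟩ := (S.coprod T).antilipschitz_of_injective_of_isClosed_range hinj
    (hrange ▸ hclosed)
  have hint (f : H) : ∫⁻ ω, (‖(Λ ω + Θ ω) f‖₊ : ℝ≥0∞) ^ 2 ∂μ
      = ENNReal.ofReal (‖(S + T) f‖ ^ 2) :=
    lintegral_eq_ofReal_norm_toLp_sq ((hLb.memLp f).add (hTb.memLp f))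
  have hlow (f : H) : ‖f‖ ≤ (c + 1) * ‖(S + T) f‖ := by
    have hle : ‖f‖ ≤ c * ‖(S + T) f‖ := by
      simpa [Prod.norm_def] using hanti.le_mul_dist (f, f) 0
    exact hle.trans (by gcongr; simp)
  refine ⟨(((c : ℝ) + 1) ^ 2)⁻¹, ‖S + T‖ ^ 2, by positivity, fun f => (hL.1 f).add (hT.1 f),
    fun f => ⟨?_, ?_⟩⟩
  · rw [hint]
    refine ENNReal.ofReal_le_ofReal ?_
    rw [inv_mul_le_iff₀ (by positivity), ← mul_pow]
    gcongr
    exact hlow f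
  · rw [hint, ← mul_pow]
    gcongr
    exact (S + T).le_opNorm f
end
end
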